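/- Let λ be an l-multipartition of n and let T be a row-strict, non-standard λ-tableau. Suppose (r,c,t) and (r,c+1,t) lie in [λ] and T(r,c+1,t) = T(r,c,t) + 1. Then there exist a Garnir node A ∈ [λ] and w ∈ S_n such that: (i) g^A(r,c+1,t) = g^A(r,c,t) + 1; (ii) T = w g^A with ℓ(T) = ℓ(w) + ℓ(g^A); and (iii) s_p w = w s_q, where p = T(r,c,t) and q = g^A(r,c,t). -/

import Mathlib

/-- A node `(r, c, t)` of (the Young diagram of) an `l`-multipartition: row `r`,
column `c`, component `t`, all 1-based. -/
abbrev MNode : Type := ℕ × ℕ × ℕ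

/-- The simple transposition `sᵢ = (i, i+1)`. -/
def sgen (i : ℕ) : Equiv.Perm ℕ := Equiv.swap i (i + 1)

/-- The Coxeter length of a permutation supported on `{1, …, n}`:
its number of inversions among `1, …, n`. -/
def invLen (n : ℕ) (w : Equiv.Perm ℕ) : ℕ :=
  ((Finset.Icc 1 n ×ˢ Finset.Icc 1 n).filter fun p => p.1 < p.2 ∧ w p.2 < w p.1).card

/-- `w` fixes every letter outside `{1, …, n}` (i.e. `w ∈ S_n`). -/
def FixOut (n : ℕ) (w : Equiv.Perm ℕ) : Prop := ∀ m, m ∉ Set.Icc 1 n → w m = m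

namespace MP

/-- `lam t r` is the length `λ^(t)_r` of the `r`-th row (1-based) of the `t`-th component
of an `l`-multipartition of `n`: each component is weakly decreasing, rows beyond the `n`-th
are empty, each row has length at most `n`, and the total number of boxes is `n`. -/
def IsMP (l n : ℕ) (lam : ℕ → ℕ → ℕ) : Prop :=
  (∀ t r, 1 ≤ r → lam t (r + 1) ≤ lam t r) ∧
  (∀ t r, n < r → lam t r = 0) ∧
  (∀ t r, lam t r ≤ n) ∧
  (∑ t ∈ Finset.Icc 1 l, ∑ r ∈ Finset.Icc 1 n, lam t r) = n

/-- The Young diagram `[λ]` of the multipartition. -/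
def diag (l : ℕ) (lam : ℕ → ℕ → ℕ) : Set MNode :=
  {x | 1 ≤ x.1 ∧ 1 ≤ x.2.1 ∧ 1 ≤ x.2.2 ∧ x.2.2 ≤ l ∧ x.2.1 ≤ lam x.2.2 x.1}

/-- A `λ`-tableau: a bijection `[λ] → {1, …, n}`. -/
def IsTab (l n : ℕ) (lam : ℕ → ℕ → ℕ) (T : MNode → ℕ) : Prop :=
  Set.BijOn T (diag l lam) (Set.Icc 1 n)

/-- Entries increase from left to right along the rows of each component. -/
def RowStrict (l : ℕ) (lam : ℕ → ℕ → ℕ) (T : MNode → ℕ) : Prop :=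
  ∀ r c t, (r, c, t) ∈ diag l lam → (r, c + 1, t) ∈ diag l lam →
    T (r, c, t) < T (r, c + 1, t)

/-- Entries increase down the columns of each component. -/
def ColStrict (l : ℕ) (lam : ℕ → ℕ → ℕ) (T : MNode → ℕ) : Prop :=
  ∀ r c t, (r, c, t) ∈ diag l lam → (r + 1, c, t) ∈ diag l lam →
    T (r, c, t) < T (r + 1, c, t)

/-- A standard `λ`-tableau. -/
def IsStd (l n : ℕ) (lam : ℕ → ℕ → ℕ) (T : MNode → ℕ) : Prop :=
  IsTab l n lam T ∧ RowStrict l lam T ∧ ColStrict l lam T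

/-- The initial tableau `t^λ`, filling `1, …, n` along successive rows of `λ^(1)`,
then of `λ^(2)`, and so on. -/
def itab (n : ℕ) (lam : ℕ → ℕ → ℕ) (x : MNode) : ℕ :=
  (∑ t' ∈ Finset.Ico 1 x.2.2, ∑ r' ∈ Finset.Icc 1 n, lam t' r') +
  (∑ r' ∈ Finset.Ico 1 x.1, lam x.2.2 r') + x.2.1

/-- `(r, c, t)` is a Garnir node of `[λ]`. -/
def IsGarnir (l : ℕ) (lam : ℕ → ℕ → ℕ) (r c t : ℕ) : Prop :=
  (r, c, t) ∈ diag l lam ∧ (r + 1, c, t) ∈ diag l lam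

/-- The Garnir belt `B^A` of the Garnir node `A = (r, c, t)`. -/
def belt (lam : ℕ → ℕ → ℕ) (r c t : ℕ) : Set MNode :=
  {x | (x.1 = r ∧ x.2.2 = t ∧ c ≤ x.2.1 ∧ x.2.1 ≤ lam t r) ∨
       (x.1 = r + 1 ∧ x.2.2 = t ∧ 1 ≤ x.2.1 ∧ x.2.1 ≤ c)}

/-- The Garnir tableau `g^A` of the Garnir node `A = (r, c, t)`: it agrees with `t^λ`
outside the Garnir belt, and the entries `u, …, v` (`u = t^λ(r,c,t)`, `v = t^λ(r+1,c,t)`)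
fill the belt in increasing order, first along row `r+1` and then along row `r`,
each from left to right. -/
def gtab (n : ℕ) (lam : ℕ → ℕ → ℕ) (r c t : ℕ) : MNode → ℕ := fun x =>
  if x.1 = r + 1 ∧ x.2.2 = t ∧ 1 ≤ x.2.1 ∧ x.2.1 ≤ c then
    itab n lam (r, c, t) + (x.2.1 - 1)
  else if x.1 = r ∧ x.2.2 = t ∧ c ≤ x.2.1 then
    itab n lam (r, c, t) + c + (x.2.1 - c)
  else itab n lam x

/-- `w` is the permutation `w^T` associated to the tableau `T`, i.e. `w ∈ S_n`
and `w t^λ = T`. -/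
def PermOf (l n : ℕ) (lam : ℕ → ℕ → ℕ) (T : MNode → ℕ) (w : Equiv.Perm ℕ) : Prop :=
  FixOut n w ∧ ∀ x ∈ diag l lam, w (itab n lam x) = T x

/-- The left (weak Bruhat) order: `v ≥_L w` iff `v = u w` with `ℓ(v) = ℓ(u) + ℓ(w)`. -/
def LeftGe (n : ℕ) (v w : Equiv.Perm ℕ) : Prop :=
  ∃ u : Equiv.Perm ℕ, FixOut n u ∧ v = u * w ∧ invLen n v = invLen n u + invLen n w

/-- The left order on `λ`-tableaux: `T ≥_L T'` iff `w^T ≥_L w^{T'}`. -/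
def TabGe (l n : ℕ) (lam : ℕ → ℕ → ℕ) (T T' : MNode → ℕ) : Prop :=
  ∃ wT wT' : Equiv.Perm ℕ, PermOf l n lam T wT ∧ PermOf l n lam T' wT' ∧ LeftGe n wT wT'

end MP

open MP

/-- The permutation exchanging the adjacent blocks `[u, u + L)` and `[u + L, u + L + b)`. -/
def blockSwap (u L b : ℕ) : Equiv.Perm ℕ where
  toFun m := if u ≤ m ∧ m < u + L then m + b
    else if u + L ≤ m ∧ m < u + L + b then m - L else m
  invFun m := if u ≤ m ∧ m < u + b then m + L
    else if u + b ≤ m ∧ m < u + b + L then m - b else m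
  left_inv m := by dsimp only; split_ifs <;> omega
  right_inv m := by dsimp only; split_ifs <;> omega

lemma blockSwap_apply (u L b m : ℕ) : blockSwap u L b m =
    if u ≤ m ∧ m < u + L then m + b
    else if u + L ≤ m ∧ m < u + L + b then m - L else m := rfl

lemma FixOut.mem_Icc_iff {n : ℕ} {w : Equiv.Perm ℕ} (hw : FixOut n w) (m : ℕ) :
    w m ∈ Set.Icc 1 n ↔ m ∈ Set.Icc 1 n := by
  constructor
  · intro h
    by_contra hm
    exact hm (hw m hm ▸ h)
  · intro h
    by_contra hm
    exact hm ((w.injective (hw _ hm)).symm ▸ h)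

lemma FixOut.inv {n : ℕ} {w : Equiv.Perm ℕ} (hw : FixOut n w) : FixOut n w⁻¹ := fun m hm => by
  rw [Equiv.Perm.inv_eq_iff_eq, hw m hm]

lemma FixOut.mul {n : ℕ} {v w : Equiv.Perm ℕ} (hv : FixOut n v) (hw : FixOut n w) :
    FixOut n (v * w) := fun m hm => by
  rw [Equiv.Perm.mul_apply, hw m hm, hv m hm]

/-- Lengths add along `v = (v σ⁻¹) σ` when every inversion of `σ` is an inversion of `v`. -/
lemma invLen_eq_add {n : ℕ} {v σ : Equiv.Perm ℕ} (hσ : FixOut n σ)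
    (h : ∀ i j, i < j → σ j < σ i → v j < v i) :
    invLen n v = invLen n (v * σ⁻¹) + invLen n σ := by
  unfold invLen
  rw [← Finset.card_filter_add_card_filter_not (fun p : ℕ × ℕ => σ p.1 < σ p.2)]
  congr 1
  · refine Finset.card_bij' (fun p _ => (σ p.1, σ p.2)) (fun p _ => (σ⁻¹ p.1, σ⁻¹ p.2))
      ?_ ?_ (by simp) (by simp)
    · rintro ⟨i, j⟩ hp
      simp only [Finset.mem_filter, Finset.mem_product, Finset.mem_Icc] at hp ⊢
      obtain ⟨⟨⟨hi, hj⟩, -, hv⟩, hlt⟩ := hp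
      exact ⟨⟨(hσ.mem_Icc_iff i).2 hi, (hσ.mem_Icc_iff j).2 hj⟩, hlt, by simpa using hv⟩
    · rintro ⟨x, y⟩ hp
      rw [Finset.mem_filter] at hp
      simp only [Finset.mem_filter, Finset.mem_product, Finset.mem_Icc] at hp ⊢
      obtain ⟨⟨hx, hy⟩, hlt, hv⟩ := hp
      refine ⟨⟨⟨(hσ.inv.mem_Icc_iff x).2 hx, (hσ.inv.mem_Icc_iff y).2 hy⟩, ?_, hv⟩, by simpa⟩
      rcases lt_trichotomy (σ⁻¹ x) (σ⁻¹ y) with h' | h' | h'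
      · exact h'
      · exact absurd (σ⁻¹.injective h') hlt.ne
      · exact absurd (h _ _ h' (by simpa using hlt)) hv.not_gt
  · congr 1
    ext ⟨i, j⟩
    simp only [Finset.mem_filter, Finset.mem_product, Finset.mem_Icc, not_lt]
    constructor
    · rintro ⟨⟨hm, hij, -⟩, hle⟩
      exact ⟨hm, hij, lt_of_le_of_ne hle fun he => hij.ne' (σ.injective he)⟩
    · rintro ⟨hm, hij, hlt⟩
      exact ⟨⟨hm, hij, h i j hij hlt⟩, hlt.le⟩

namespace MP

lemma itab_row (n : ℕ) (lam : ℕ → ℕ → ℕ) (r b k t : ℕ) (hk : b ≤ k) :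
    itab n lam (r, k, t) = itab n lam (r, b, t) + (k - b) := by
  simp only [itab]; omega

lemma itab_next_row (n : ℕ) (lam : ℕ → ℕ → ℕ) (r b k t : ℕ) (hr : 1 ≤ r) (hb : b ≤ lam t r) :
    itab n lam (r + 1, k, t) = itab n lam (r, b, t) + (lam t r - b) + k := by
  simp only [itab, Finset.sum_Ico_succ_top hr]; omega

lemma PermOf.itab_bijOn {l n : ℕ} {lam : ℕ → ℕ → ℕ} {T : MNode → ℕ} {w : Equiv.Perm ℕ}
    (hw : PermOf l n lam T w) (hT : IsTab l n lam T) :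
    Set.BijOn (itab n lam) (diag l lam) (Set.Icc 1 n) := by
  refine ⟨fun x hx => ?_, fun x hx y hy hxy => ?_, fun m hm => ?_⟩
  · rw [← hw.1.mem_Icc_iff, hw.2 x hx]
    exact hT.mapsTo hx
  · apply hT.injOn hx hy
    rw [← hw.2 x hx, ← hw.2 y hy, hxy]
  · obtain ⟨x, hx, hxm⟩ := hT.surjOn ((hw.1.mem_Icc_iff m).2 hm)
    exact ⟨x, hx, w.injective (by rw [hw.2 x hx, hxm])⟩

lemma PermOf.unique {l n : ℕ} {lam : ℕ → ℕ → ℕ} {T : MNode → ℕ} {v w : Equiv.Perm ℕ}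
    (hv : PermOf l n lam T v) (hw : PermOf l n lam T w)
    (hi : Set.BijOn (itab n lam) (diag l lam) (Set.Icc 1 n)) : v = w := by
  ext m
  by_cases hm : m ∈ Set.Icc 1 n
  · obtain ⟨x, hx, rfl⟩ := hi.surjOn hm
    rw [hv.2 x hx, hw.2 x hx]
  · rw [hv.1 m hm, hw.1 m hm]

lemma RowStrict.le {l : ℕ} {lam : ℕ → ℕ → ℕ} {T : MNode → ℕ} (hT : RowStrict l lam T)
    {r b k t : ℕ} (hb : (r, b, t) ∈ diag l lam) (hk : (r, k, t) ∈ diag l lam) (hbk : b ≤ k) :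
    T (r, b, t) ≤ T (r, k, t) := by
  induction k, hbk using Nat.le_induction with
  | base => exact le_rfl
  | succ k hbk ih =>
    have hk' : (r, k, t) ∈ diag l lam := by simp only [diag, Set.mem_ofPred_eq] at *; omega
    exact (ih hk').trans (hT r k t hk' hk).le

/-- The permutation `w^{g^A}` of the Garnir tableau of `A = (r, c, t)`. -/
def garnirPerm (n : ℕ) (lam : ℕ → ℕ → ℕ) (r c t : ℕ) : Equiv.Perm ℕ :=
  blockSwap (itab n lam (r, c, t)) (lam t r - c + 1) c

lemma exists_node_of_mem_upper {l n : ℕ} {lam : ℕ → ℕ → ℕ} {r c t m : ℕ}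
    (hA : IsGarnir l lam r c t) (hm : itab n lam (r, c, t) ≤ m)
    (hm' : m < itab n lam (r, c, t) + (lam t r - c + 1)) :
    ∃ k, c ≤ k ∧ (r, k, t) ∈ diag l lam ∧ itab n lam (r, k, t) = m := by
  have h := hA.1
  simp only [diag, Set.mem_ofPred_eq] at h ⊢
  refine ⟨c + (m - itab n lam (r, c, t)), by omega, by omega, ?_⟩
  rw [itab_row n lam r c _ t (by omega)]
  omega

lemma exists_node_of_mem_lower {l n : ℕ} {lam : ℕ → ℕ → ℕ} {r c t m : ℕ}
    (hA : IsGarnir l lam r c t) (hm : itab n lam (r, c, t) + (lam t r - c + 1) ≤ m)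
    (hm' : m < itab n lam (r, c, t) + (lam t r - c + 1) + c) :
    ∃ k, 1 ≤ k ∧ k ≤ c ∧ (r + 1, k, t) ∈ diag l lam ∧ itab n lam (r + 1, k, t) = m := by
  obtain ⟨h, h'⟩ := hA
  simp only [diag, Set.mem_ofPred_eq] at h h' ⊢
  refine ⟨m - (itab n lam (r, c, t) + (lam t r - c)), by omega, by omega, by omega, ?_⟩
  rw [itab_next_row n lam r c _ t (by omega) (by omega)]
  omega

lemma permOf_garnirPerm {l n : ℕ} {lam : ℕ → ℕ → ℕ} {r c t : ℕ} (hA : IsGarnir l lam r c t)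
    (hi : Set.BijOn (itab n lam) (diag l lam) (Set.Icc 1 n)) :
    PermOf l n lam (gtab n lam r c t) (garnirPerm n lam r c t) := by
  constructor
  · intro m hm
    rw [garnirPerm, blockSwap_apply, if_neg, if_neg]
    · rintro ⟨h, h'⟩
      obtain ⟨k, -, -, hk, rfl⟩ := exists_node_of_mem_lower hA h h'
      exact hm (hi.mapsTo hk)
    · rintro ⟨h, h'⟩
      obtain ⟨k, -, hk, rfl⟩ := exists_node_of_mem_upper hA h h'
      exact hm (hi.mapsTo hk)
  · rintro ⟨a, k, s⟩ hx
    have h := hA.1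
    have h' := hA.2
    have hx' := hx
    simp only [diag, Set.mem_ofPred_eq] at h h' hx'
    rw [garnirPerm, blockSwap_apply, gtab]
    by_cases hlow : a = r + 1 ∧ s = t ∧ 1 ≤ k ∧ k ≤ c
    · obtain ⟨rfl, rfl, hk⟩ := hlow
      have := itab_next_row n lam r c k s (by omega) (by omega)
      rw [if_neg (by omega), if_pos (by omega), if_pos ⟨rfl, rfl, hk⟩]
      dsimp only
      omega
    by_cases hup : a = r ∧ s = t ∧ c ≤ k
    · obtain ⟨rfl, rfl, hk⟩ := hup
      have := itab_row n lam a c k s hk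
      rw [if_pos (by omega), if_neg hlow, if_pos ⟨rfl, rfl, hk⟩]
      dsimp only
      omega
    rw [if_neg hlow, if_neg hup, if_neg, if_neg]
    · rintro ⟨hm, hm'⟩
      obtain ⟨k', hk, hkc, hkd, he⟩ := exists_node_of_mem_lower hA hm hm'
      obtain ⟨rfl, rfl, rfl⟩ : r + 1 = a ∧ k' = k ∧ t = s := by simpa using hi.injOn hkd hx he
      exact hlow ⟨rfl, rfl, hk, hkc⟩
    · rintro ⟨hm, hm'⟩
      obtain ⟨k', hk, hkd, he⟩ := exists_node_of_mem_upper hA hm hm'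
      obtain ⟨rfl, rfl, rfl⟩ : r = a ∧ k' = k ∧ t = s := by simpa using hi.injOn hkd hx he
      exact hup ⟨rfl, rfl, hk⟩

lemma lt_of_inversion_garnirPerm {l n : ℕ} {lam : ℕ → ℕ → ℕ} {T : MNode → ℕ}
    {w : Equiv.Perm ℕ} {r c t : ℕ} (hw : PermOf l n lam T w) (hT : RowStrict l lam T)
    (hA : IsGarnir l lam r c t) (hlt : T (r + 1, c, t) < T (r, c, t)) (i j : ℕ) (hij : i < j)
    (hinv : garnirPerm n lam r c t j < garnirPerm n lam r c t i) : w j < w i := by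
  simp only [garnirPerm, blockSwap_apply] at hinv
  have hblocks : (itab n lam (r, c, t) ≤ i ∧ i < itab n lam (r, c, t) + (lam t r - c + 1)) ∧
      (itab n lam (r, c, t) + (lam t r - c + 1) ≤ j ∧
        j < itab n lam (r, c, t) + (lam t r - c + 1) + c) := by
    split_ifs at hinv <;> omega
  obtain ⟨k, hk, hkd, rfl⟩ := exists_node_of_mem_upper hA hblocks.1.1 hblocks.1.2
  obtain ⟨k', -, hk', hkd', rfl⟩ := exists_node_of_mem_lower hA hblocks.2.1 hblocks.2.2
  rw [hw.2 _ hkd, hw.2 _ hkd']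
  exact (hT.le hkd' hA.2 hk').trans_lt (hlt.trans_le (hT.le hA.1 hkd hk))

/-- A column descent of `T` at a Garnir node may be moved so that the belt does not separate
two horizontally adjacent nodes whose entries are consecutive. -/
lemma exists_garnir_descent {l n : ℕ} {lam : ℕ → ℕ → ℕ} (hMP : IsMP l n lam) {T : MNode → ℕ}
    (hTab : IsTab l n lam T) (hRow : RowStrict l lam T) (hNStd : ¬ IsStd l n lam T)
    {r c t : ℕ} (h1 : (r, c, t) ∈ diag l lam) (h2 : (r, c + 1, t) ∈ diag l lam)
    (hval : T (r, c + 1, t) = T (r, c, t) + 1) :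
    ∃ a b s, IsGarnir l lam a b s ∧ T (a + 1, b, s) < T (a, b, s) ∧
      ¬ (r = a ∧ t = s ∧ c + 1 = b) ∧ ¬ (r = a + 1 ∧ t = s ∧ c = b) := by
  have hcol : ¬ ColStrict l lam T := fun h => hNStd ⟨hTab, hRow, h⟩
  simp only [ColStrict, not_forall, not_lt] at hcol
  obtain ⟨a, b, s, hd, hd', hle⟩ := hcol
  have hlt : T (a + 1, b, s) < T (a, b, s) := lt_of_le_of_ne hle fun he => by
    simpa using hTab.injOn hd' hd he
  by_cases hu : r = a ∧ t = s ∧ c + 1 = b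
  · obtain ⟨rfl, rfl, rfl⟩ := hu
    have hd₁ : (r + 1, c, t) ∈ diag l lam := by
      simp only [diag, Set.mem_ofPred_eq] at *; omega
    have := hRow _ _ _ hd₁ hd'
    exact ⟨r, c, t, ⟨h1, hd₁⟩, by omega, by omega, by omega⟩
  by_cases hv : r = a + 1 ∧ t = s ∧ c = b
  · obtain ⟨rfl, rfl, rfl⟩ := hv
    have hd₁ : (a, c + 1, t) ∈ diag l lam := by
      have := hMP.1 t a
      simp only [diag, Set.mem_ofPred_eq] at *; omega
    have := hRow _ _ _ hd hd₁
    exact ⟨a, c + 1, t, ⟨hd₁, h2⟩, by omega, by omega, by omega⟩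
  exact ⟨a, b, s, ⟨hd, hd'⟩, hlt, hu, hv⟩

lemma gtab_succ (n : ℕ) (lam : ℕ → ℕ → ℕ) {a b s r c t : ℕ} (hc : 1 ≤ c)
    (hu : ¬ (r = a ∧ t = s ∧ c + 1 = b)) (hv : ¬ (r = a + 1 ∧ t = s ∧ c = b)) :
    gtab n lam a b s (r, c + 1, t) = gtab n lam a b s (r, c, t) + 1 := by
  have := itab_row n lam r c (c + 1) t (by omega)
  simp only [gtab]
  split_ifs <;> omega

end MP

/-- Let `T` be a row-strict, non-standard `λ`-tableau with
`(r,c,t), (r,c+1,t) ∈ [λ]` and `T(r,c+1,t) = T(r,c,t) + 1`.  Then there exist a Garnir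
node `A ∈ [λ]` and `w ∈ S_n` such that (i) `g^A(r,c+1,t) = g^A(r,c,t) + 1`;
(ii) `T = w g^A` with `ℓ(T) = ℓ(w) + ℓ(g^A)`; (iii) `s_p w = w s_q`, where
`p = T(r,c,t)` and `q = g^A(r,c,t)`. -/
theorem stmt5 (l n : ℕ) (hl : 1 ≤ l) (lam : ℕ → ℕ → ℕ) (hMP : IsMP l n lam)
    (T : MNode → ℕ) (hTab : IsTab l n lam T) (hRow : RowStrict l lam T)
    (hNStd : ¬ IsStd l n lam T)
    (r c t : ℕ) (h1 : (r, c, t) ∈ diag l lam) (h2 : (r, c + 1, t) ∈ diag l lam)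
    (hval : T (r, c + 1, t) = T (r, c, t) + 1)
    (wT : Equiv.Perm ℕ) (hwT : PermOf l n lam T wT) :
    ∃ r' c' t' : ℕ, IsGarnir l lam r' c' t' ∧
    ∃ w : Equiv.Perm ℕ, FixOut n w ∧
      gtab n lam r' c' t' (r, c + 1, t) = gtab n lam r' c' t' (r, c, t) + 1 ∧
      (∀ x ∈ diag l lam, T x = w (gtab n lam r' c' t' x)) ∧
      (∀ wG : Equiv.Perm ℕ, PermOf l n lam (gtab n lam r' c' t') wG →
        invLen n wT = invLen n w + invLen n wG) ∧
      sgen (T (r, c, t)) * w = w * sgen (gtab n lam r' c' t' (r, c, t)) := by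
  have hi := hwT.itab_bijOn hTab
  obtain ⟨a, b, s, hA, hlt, hu, hv⟩ := exists_garnir_descent hMP hTab hRow hNStd h1 h2 hval
  have hg := permOf_garnirPerm hA hi
  have hsucc := gtab_succ n lam (a := a) (b := b) (s := s) h1.2.1 hu hv
  have hw : ∀ x ∈ diag l lam, T x = (wT * (garnirPerm n lam a b s)⁻¹) (gtab n lam a b s x) :=
    fun x hx => by rw [← hg.2 x hx, ← hwT.2 x hx]; simp
  refine ⟨a, b, s, hA, wT * (garnirPerm n lam a b s)⁻¹, hwT.1.mul hg.1.inv, hsucc, hw, ?_, ?_⟩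
  · intro wG hwG
    rw [hwG.unique hg hi]
    exact invLen_eq_add hg.1 (lt_of_inversion_garnirPerm hwT hRow hA hlt)
  · rw [sgen, sgen, ← hval, ← hsucc, Equiv.mul_swap_eq_swap_mul, ← hw _ h1, ← hw _ h2]
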